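/- Let p be an odd prime, let m ≥ 1, and let μ^{(0)} ⊇ μ^{(1)} ⊇ ⋯ ⊇ μ^{(m)} be partitions. Let G be a finite abelian p-group of type μ^{(0)}. Then the number of chains of subgroups G = G_0 ⊇ G_1 ⊇ ⋯ ⊇ G_m such that G_i is of type μ^{(i)} for each i equals p^{n(μ^{(0)}) − n(μ^{(m)})} · ∏_{i=1}^{m} sk_{μ^{(i−1)}/μ^{(i)}}(p^{−1}), as an equality of rational numbers. -/

import Mathlib

open scoped BigOperators Classical

namespace EK

/-- Conjugate partition: `conj f j = #{i : f i ≥ j}` (parts of `f` are `f 0, f 1, …`,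
i.e. `f i = λ_{i+1}`). -/
noncomputable def conj (f : ℕ → ℕ) (j : ℕ) : ℕ := Nat.card {i : ℕ // j ≤ f i}

/-- `f` represents a partition: weakly decreasing with finitely many nonzero parts. -/
def IsPartition (f : ℕ → ℕ) : Prop := Antitone f ∧ ∃ N, ∀ i, N ≤ i → f i = 0

/-- `l(f) = n`: the first `n` parts are positive, the rest vanish. -/
def HasLength (f : ℕ → ℕ) (n : ℕ) : Prop := (∀ i < n, 0 < f i) ∧ ∀ i, n ≤ i → f i = 0

/-- `|λ| = Σ_i λ_i`. -/
noncomputable def psize (f : ℕ → ℕ) : ℕ := ∑ᶠ i, f i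

/-- `n(λ) = Σ_{i ≥ 1} (i-1) λ_i` (0-indexed: `Σ_i i * f i`). -/
noncomputable def nstat (f : ℕ → ℕ) : ℕ := ∑ᶠ i, i * f i

/-- `φ_r(u) = ∏_{i=1}^r (1 - u^i)`. -/
def phiPoch {F : Type*} [Field F] (u : F) (r : ℕ) : F := ∏ i ∈ Finset.Icc 1 r, (1 - u ^ i)

/-- Gaussian binomial `binom(a,b)_u = φ_a(u)/(φ_b(u) φ_{a-b}(u))` for `0 ≤ b ≤ a`, `0` otherwise. -/
noncomputable def gauss {F : Type*} [Field F] (u : F) (a b : ℤ) : F :=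
  if 0 ≤ b ∧ b ≤ a then phiPoch u a.toNat / (phiPoch u b.toNat * phiPoch u (a - b).toNat)
  else 0

/-- `sk_{λ/μ}(u) = u^{Σ_{j≥1} C(λ'_j - μ'_j, 2)} ∏_{j≥1} binom(λ'_j - μ'_{j+1}, m_j(μ))_u`
(the factors for `j > λ_1` are all `1` and the exponents vanish there, so the product and
sum are taken over `1 ≤ j ≤ λ_1 = f 0`). -/
noncomputable def sk {F : Type*} [Field F] (u : F) (f g : ℕ → ℕ) : F :=
  u ^ (∑ j ∈ Finset.Icc 1 (f 0), Nat.choose (conj f j - conj g j) 2) *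
    ∏ j ∈ Finset.Icc 1 (f 0),
      gauss u ((conj f j : ℤ) - (conj g (j + 1) : ℤ)) ((conj g j : ℤ) - (conj g (j + 1) : ℤ))

/-- `μ ⊆ λ` and `λ/μ` is a horizontal strip, i.e. `λ'_j - μ'_j ∈ {0,1}` for all `j ≥ 1`. -/
def IsHStrip (f g : ℕ → ℕ) : Prop :=
  (∀ i, g i ≤ f i) ∧ ∀ j, 1 ≤ j → conj f j ≤ conj g j + 1

/-- `φ_{λ/μ}(u) = ∏_{j ≥ 1, λ'_j = μ'_j + 1, λ'_{j+1} = μ'_{j+1}} (1 - u^{m_j(λ)})` if `λ/μ` is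
a horizontal strip, and `0` otherwise (factors with `j > λ_1` never occur). -/
noncomputable def phiStrip {F : Type*} [Field F] (u : F) (f g : ℕ → ℕ) : F :=
  if IsHStrip f g then
    ∏ j ∈ (Finset.Icc 1 (f 0)).filter
        (fun j => conj f j = conj g j + 1 ∧ conj f (j + 1) = conj g (j + 1)),
      (1 - u ^ (conj f j - conj f (j + 1)))
  else 0

/-- `b_λ(u) = ∏_{i ≥ 1} φ_{m_i(λ)}(u)` (factors with `i > λ_1` are `1`). -/
noncomputable def bcoef {F : Type*} [Field F] (u : F) (f : ℕ → ℕ) : F :=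
  ∏ i ∈ Finset.Icc 1 (f 0), phiPoch u (conj f i - conj f (i + 1))

/-- The standard abelian `p`-group with cyclic factors of orders `p ^ f 0, …, p ^ f (n - 1)`. -/
abbrev StdGroup (p : ℕ) (f : ℕ → ℕ) (n : ℕ) : Type := ∀ j : Fin n, ZMod (p ^ f (j : ℕ))

/-- Splitting off the last cyclic factor of a standard group. -/
def stdGroupSucc (p : ℕ) (f : ℕ → ℕ) (n : ℕ) :
    StdGroup p f (n + 1) ≃+ StdGroup p f n × ZMod (p ^ f n) where
  toFun x := (fun j => x j.castSucc, x (Fin.last n))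
  invFun y := Fin.snoc (α := fun j : Fin (n + 1) => ZMod (p ^ f (j : ℕ))) y.1 y.2
  left_inv x := by
    funext j
    refine Fin.lastCases ?_ (fun i => ?_) j <;> simp
  right_inv y := by
    ext <;> simp
  map_add' x y := rfl

theorem card_torsion_zmod (p : ℕ) [Fact p.Prime] (a k : ℕ) :
    Nat.card {x : ZMod (p ^ a) // p ^ k • x = 0} = p ^ min a k := by
  have h := IsAddCyclic.card_nsmulAddMonoidHom_ker (G := ZMod (p ^ a)) (p ^ k)
  rw [Nat.card_zmod] at h
  have hg : (p ^ a).gcd (p ^ k) = p ^ min a k := by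
    rcases le_total a k with hak | hak
    · rw [min_eq_left hak, Nat.gcd_eq_left (pow_dvd_pow p hak)]
    · rw [min_eq_right hak, Nat.gcd_eq_right (pow_dvd_pow p hak)]
  rw [hg] at h
  rw [← h]
  exact Nat.card_congr (Equiv.subtypeEquivRight fun x => by simp [AddMonoidHom.mem_ker])

theorem card_torsion_stdGroup (p : ℕ) [Fact p.Prime] (f : ℕ → ℕ) (n k : ℕ) :
    Nat.card {x : StdGroup p f n // p ^ k • x = 0} = p ^ ∑ i ∈ Finset.range n, min (f i) k := by
  have e : {x : StdGroup p f n // p ^ k • x = 0} ≃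
      ∀ j : Fin n, {y : ZMod (p ^ f (j : ℕ)) // p ^ k • y = 0} :=
    (Equiv.subtypeEquivRight fun x => by
      rw [funext_iff]; rfl).trans
      (Equiv.subtypePiEquivPi (p := fun (j : Fin n) (y : ZMod (p ^ f (j : ℕ))) => p ^ k • y = 0))
  rw [Nat.card_congr e, Nat.card_pi, ← Finset.prod_pow_eq_pow_sum, Finset.prod_range]
  exact Finset.prod_congr rfl fun j _ => card_torsion_zmod p _ k

/-- If every cyclic factor has order at least `p ^ (s + 1)`, then the `p`-torsion elements of the
standard group are divisible by `p ^ s`. -/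
theorem exists_nsmul_eq_of_torsion (p : ℕ) [Fact p.Prime] (f : ℕ → ℕ) (n s : ℕ)
    (hf : ∀ i < n, s + 1 ≤ f i) (x : StdGroup p f n) (hx : p • x = 0) :
    ∃ y : StdGroup p f n, p ^ s • y = x := by
  have key : ∀ j : Fin n, ∃ y : ZMod (p ^ f (j : ℕ)), p ^ s • y = x j := by
    intro j
    obtain ⟨z, hz⟩ := ZMod.intCast_surjective (x j)
    obtain ⟨c, hc⟩ : ∃ c, f (j : ℕ) = s + 1 + c := Nat.exists_eq_add_of_le (hf j j.2)
    have h0 : ((p * z : ℤ) : ZMod (p ^ f (j : ℕ))) = 0 := by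
      have := congrFun hx j
      rw [Pi.smul_apply, ← hz, nsmul_eq_mul] at this
      simpa using this
    rw [ZMod.intCast_zmod_eq_zero_iff_dvd] at h0
    have hp0 : (p : ℤ) ≠ 0 := by exact_mod_cast (Fact.out : p.Prime).ne_zero
    have h1 : (p : ℤ) ^ (s + c) ∣ z := by
      rw [hc] at h0
      push_cast at h0
      rw [show s + 1 + c = (s + c) + 1 by ring, pow_succ'] at h0
      exact (mul_dvd_mul_iff_left hp0).1 h0
    obtain ⟨w, hw⟩ := h1
    refine ⟨((p ^ c * w : ℤ) : ZMod _), ?_⟩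
    rw [← hz, hw, nsmul_eq_mul]
    push_cast
    ring
  choose y hy using key
  exact ⟨y, funext hy⟩

theorem card_nsmul_mem_range {G H : Type*} [AddCommGroup G] [AddCommGroup H] (p s : ℕ)
    (hH : ∀ h : H, p • h = 0 → ∃ h', p ^ s • h' = h) (g : H →+ G) (hg : Function.Injective g) :
    Nat.card {x : G // p ^ (s + 1) • x = 0 ∧ p ^ s • x ∈ g.range} =
      Nat.card {h : H // p • h = 0} * Nat.card {x : G // p ^ s • x = 0} := by
  choose! σ hσ using hH
  rw [← Nat.card_prod]
  symm
  refine Nat.card_congr (Equiv.ofBijective (fun q => ⟨g (σ q.1) + q.2, ?_, ?_⟩) ⟨?_, ?_⟩)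
  · obtain ⟨⟨h, hh⟩, ⟨y, hy⟩⟩ := q
    simp only
    rw [pow_succ', mul_nsmul', smul_add, hy, ← map_nsmul, hσ h hh, add_zero, ← map_nsmul, hh,
      map_zero]
  · obtain ⟨⟨h, hh⟩, ⟨y, hy⟩⟩ := q
    exact ⟨h, by simp only [smul_add, hy, ← map_nsmul, hσ h hh, add_zero]⟩
  · rintro ⟨⟨h, hh⟩, ⟨y, hy⟩⟩ ⟨⟨h', hh'⟩, ⟨y', hy'⟩⟩ heq
    have heq' : g (σ h) + y = g (σ h') + y' := congrArg Subtype.val heq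
    have h1 := congrArg (fun z => p ^ s • z) heq'
    simp only [smul_add, hy, hy', ← map_nsmul, hσ h hh, hσ h' hh', add_zero] at h1
    obtain rfl := hg h1
    obtain rfl := add_left_cancel heq'
    rfl
  · rintro ⟨x, hx, h, hh⟩
    have hph : p • h = 0 := by
      apply hg
      rw [map_nsmul, hh, ← mul_nsmul', ← pow_succ', hx, map_zero]
    refine ⟨⟨⟨h, hph⟩, ⟨x - g (σ h), ?_⟩⟩, Subtype.ext ?_⟩
    · rw [smul_sub, ← map_nsmul, hσ h hph, hh, sub_self]
    · simp

theorem zmod_hom_apply_intCast {G : Type*} [AddCommGroup G] {n : ℕ} (f : ZMod n →+ G) (z : ℤ) :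
    f (z : ZMod n) = z • f 1 := by
  rw [← map_zsmul, zsmul_one]

/-- Homomorphisms out of `ZMod n` are `n`-torsion elements. -/
def zmodHomEquiv (G : Type*) [AddCommGroup G] (n : ℕ) : (ZMod n →+ G) ≃ {x : G // n • x = 0} where
  toFun f := ⟨f 1, by rw [← map_nsmul, nsmul_one, ZMod.natCast_self, map_zero]⟩
  invFun x := ZMod.lift n ⟨zmultiplesHom G x.1, by simpa using x.2⟩
  left_inv f := by
    ext z
    obtain ⟨z, rfl⟩ := ZMod.intCast_surjective z
    rw [ZMod.lift_coe, zmod_hom_apply_intCast]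
    simp
  right_inv x := by
    ext
    have := ZMod.lift_coe n ⟨zmultiplesHom G x.1, by simpa using x.2⟩ 1
    simpa using this

theorem injective_coprod_iff {G H : Type*} [AddCommGroup G] [AddCommGroup H] (p s : ℕ)
    [Fact p.Prime] (g : H →+ G) (c : ZMod (p ^ (s + 1)) →+ G) :
    Function.Injective (g.coprod c) ↔ Function.Injective g ∧ p ^ s • c 1 ∉ g.range := by
  have hp : p.Prime := Fact.out
  constructor
  · intro h
    refine ⟨fun a b hab => ?_, ?_⟩
    · have : (a, (0 : ZMod (p ^ (s + 1)))) = (b, 0) := h (by simpa using hab)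
      exact congrArg Prod.fst this
    · rintro ⟨a, ha⟩
      have : (a, (0 : ZMod (p ^ (s + 1)))) = (0, ((p ^ s : ℕ) : ZMod (p ^ (s + 1)))) := by
        apply h
        rw [AddMonoidHom.coprod_apply, AddMonoidHom.coprod_apply, map_zero, map_zero, add_zero,
          zero_add, ha, ← map_nsmul, nsmul_one]
      have h0 : ((p ^ s : ℕ) : ZMod (p ^ (s + 1))) = 0 := (congrArg Prod.snd this).symm
      rw [ZMod.natCast_eq_zero_iff] at h0
      have := (Nat.pow_dvd_pow_iff_le_right hp.one_lt).1 h0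
      omega
  · rintro ⟨hg, hc⟩
    rw [injective_iff_map_eq_zero]
    rintro ⟨a, b⟩ hab
    rw [AddMonoidHom.coprod_apply] at hab
    by_cases hb : b = 0
    · subst hb
      rw [map_zero, add_zero] at hab
      rw [(injective_iff_map_eq_zero g).1 hg a hab]
      rfl
    · exfalso
      apply hc
      obtain ⟨z, rfl⟩ := ZMod.intCast_surjective b
      have hgcd : ∃ u v : ℤ, z * u + p ^ (s + 1) * v = p ^ s := by
        have hd : Int.gcd z (p ^ (s + 1) : ℕ) ∣ p ^ s := by
          have h1 : Int.gcd z (p ^ (s + 1) : ℕ) ∣ p ^ (s + 1) := by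
            exact_mod_cast Int.gcd_dvd_right z ((p ^ (s + 1) : ℕ) : ℤ)
          obtain ⟨i, hi, hi'⟩ := (Nat.dvd_prime_pow hp).1 h1
          rw [hi']
          refine pow_dvd_pow p ?_
          by_contra hlt
          obtain rfl : i = s + 1 := by omega
          apply hb
          rw [ZMod.intCast_zmod_eq_zero_iff_dvd, ← hi']
          exact Int.gcd_dvd_left z _
        obtain ⟨w, hw⟩ := hd
        refine ⟨Int.gcdA z (p ^ (s + 1) : ℕ) * w, Int.gcdB z (p ^ (s + 1) : ℕ) * w, ?_⟩
        have hbez := Int.gcd_eq_gcd_ab z (p ^ (s + 1) : ℕ)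
        have hw' : (p : ℤ) ^ s = (Int.gcd z (p ^ (s + 1) : ℕ) : ℤ) * w := by exact_mod_cast hw
        rw [hw', hbez]
        push_cast
        ring
      obtain ⟨u, v, huv⟩ := hgcd
      refine ⟨-(u • a), ?_⟩
      have h1 : c ((z : ℤ) : ZMod (p ^ (s + 1))) = - g a := by
        rw [eq_neg_iff_add_eq_zero, add_comm]; exact hab
      have h2 : ((p ^ s : ℕ) : ZMod (p ^ (s + 1))) = ((u * z : ℤ) : ZMod (p ^ (s + 1))) := by
        have h3 := congrArg (Int.cast : ℤ → ZMod (p ^ (s + 1))) huv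
        have h4 : ((p : ZMod (p ^ (s + 1))) ^ (s + 1)) = 0 := by
          exact_mod_cast ZMod.natCast_self (p ^ (s + 1))
        push_cast at h3 ⊢
        rw [h4, zero_mul, add_zero] at h3
        rw [← h3, mul_comm]
      rw [← map_nsmul, nsmul_one, h2, zmod_hom_apply_intCast, mul_zsmul, ← zmod_hom_apply_intCast,
        h1, map_neg, map_zsmul, smul_neg]

/-- Injective homomorphisms out of `H × ZMod (p ^ (s + 1))`, as extensions of injective
homomorphisms out of `H`. -/
def injectiveHomProdEquiv (G H : Type*) [AddCommGroup G] [AddCommGroup H] (p s : ℕ)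
    [Fact p.Prime] :
    {f : H × ZMod (p ^ (s + 1)) →+ G // Function.Injective f} ≃
      Σ g : {g : H →+ G // Function.Injective g},
        {x : G // p ^ (s + 1) • x = 0 ∧ p ^ s • x ∉ g.1.range} where
  toFun f :=
    have hf : Function.Injective (f.1.comp (AddMonoidHom.inl _ _)) ∧
        p ^ s • (f.1.comp (AddMonoidHom.inr _ _)) 1 ∉ (f.1.comp (AddMonoidHom.inl _ _)).range := by
      rw [← injective_coprod_iff, AddMonoidHom.coprod_unique]
      exact f.2
    ⟨⟨f.1.comp (AddMonoidHom.inl _ _), hf.1⟩, ⟨f.1.comp (AddMonoidHom.inr _ _) 1,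
      (zmodHomEquiv G _ (f.1.comp (AddMonoidHom.inr _ _))).2, hf.2⟩⟩
  invFun q := ⟨q.1.1.coprod ((zmodHomEquiv G _).symm ⟨q.2.1, q.2.2.1⟩), by
    rw [injective_coprod_iff]
    refine ⟨q.1.2, ?_⟩
    have h := congrArg Subtype.val
      ((zmodHomEquiv G (p ^ (s + 1))).apply_symm_apply ⟨q.2.1, q.2.2.1⟩)
    have h' : (zmodHomEquiv G (p ^ (s + 1))).symm ⟨q.2.1, q.2.2.1⟩ 1 = q.2.1 := h
    rw [h']
    exact q.2.2.2⟩
  left_inv f := by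
    apply Subtype.ext
    have h : (zmodHomEquiv G (p ^ (s + 1))).symm (zmodHomEquiv G _ (f.1.comp (AddMonoidHom.inr _ _)))
      = f.1.comp (AddMonoidHom.inr _ _) := Equiv.symm_apply_apply _ _
    have h' := AddMonoidHom.coprod_unique f.1
    rw [← h] at h'
    exact h'
  right_inv q := by
    obtain ⟨⟨g, hg⟩, ⟨x, hx, hx'⟩⟩ := q
    have h : (zmodHomEquiv G (p ^ (s + 1))).symm ⟨x, hx⟩ 1 = x :=
      congrArg Subtype.val ((zmodHomEquiv G (p ^ (s + 1))).apply_symm_apply ⟨x, hx⟩)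
    have hl : (g.coprod ((zmodHomEquiv G (p ^ (s + 1))).symm ⟨x, hx⟩)).comp
      (AddMonoidHom.inl _ _) = g := AddMonoidHom.coprod_comp_inl _ _
    apply Sigma.ext
    · exact Subtype.ext hl
    · rw [Subtype.heq_iff_coe_eq]
      · simpa using h
      · intro y
        simp only [hl]

instance finite_addMonoidHom {G H : Type*} [AddCommGroup G] [AddCommGroup H] [Finite G]
    [Finite H] : Finite (H →+ G) := Finite.of_injective _ DFunLike.coe_injective

theorem card_injectiveHom_stdGroup (p : ℕ) [Fact p.Prime] (f : ℕ → ℕ) (hf : Antitone f)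
    (G : Type*) [AddCommGroup G] [Finite G] (n : ℕ) (hn : ∀ i < n, 0 < f i) :
    (Nat.card {g : StdGroup p f n →+ G // Function.Injective g} : ℚ) =
      ∏ i ∈ Finset.range n, ((Nat.card {x : G // p ^ f i • x = 0} : ℚ) -
        p ^ i * Nat.card {x : G // p ^ (f i - 1) • x = 0}) := by
  induction n with
  | zero =>
    have : Unique {g : StdGroup p f 0 →+ G // Function.Injective g} :=
      { default := ⟨0, Function.injective_of_subsingleton _⟩
        uniq := fun g => Subtype.ext (AddMonoidHom.ext fun x => by
          rw [Subsingleton.elim x 0, map_zero, map_zero]) }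
    simp
  | succ n ih =>
    rw [Finset.prod_range_succ, ← ih fun i hi => hn i (by omega)]
    obtain ⟨s, hs⟩ : ∃ s, f n = s + 1 := Nat.exists_eq_succ_of_ne_zero (hn n (by omega)).ne'
    have e : {g : StdGroup p f (n + 1) →+ G // Function.Injective g} ≃
        {g : StdGroup p f n × ZMod (p ^ (s + 1)) →+ G // Function.Injective g} := by
      rw [← hs]
      refine Equiv.subtypeEquiv ((stdGroupSucc p f n).addMonoidHomCongrLeftEquiv) fun g => ?_
      exact (Function.Injective.of_comp_iff' g (stdGroupSucc p f n).symm.bijective).symm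
    rw [Nat.card_congr (e.trans (injectiveHomProdEquiv G _ p s))]
    have : Fintype {g : StdGroup p f n →+ G // Function.Injective g} := Fintype.ofFinite _
    rw [Nat.card_sigma]
    push_cast
    rw [Finset.sum_congr rfl (g := fun _ => ((Nat.card {x : G // p ^ f n • x = 0} : ℚ) -
        p ^ n * Nat.card {x : G // p ^ (f n - 1) • x = 0})), Finset.sum_const, Finset.card_univ,
        ← Nat.card_eq_fintype_card, nsmul_eq_mul]
    rintro ⟨g, hg⟩ -
    rw [hs, Nat.add_sub_cancel]
    have htors : Nat.card {x : StdGroup p f n // p • x = 0} = p ^ n := by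
      have h := card_torsion_stdGroup p f n 1
      rw [pow_one] at h
      rw [h, Finset.sum_congr rfl (g := fun _ => 1)]
      · simp
      · intro i hi
        have := hn i (by have := Finset.mem_range.1 hi; omega)
        omega
    have h1 := card_nsmul_mem_range p s
      (exists_nsmul_eq_of_torsion p f n s fun i hi => hs ▸ hf hi.le) g hg
    rw [htors] at h1
    have h2 : Nat.card {x : G // p ^ (s + 1) • x = 0} =
        Nat.card {x : G // p ^ (s + 1) • x = 0 ∧ p ^ s • x ∈ g.range} +
        Nat.card {x : G // p ^ (s + 1) • x = 0 ∧ p ^ s • x ∉ g.range} := by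
      rw [← Nat.card_sum]
      exact Nat.card_congr (((Equiv.sumCompl _).symm.trans (Equiv.sumCongr
        (Equiv.subtypeSubtypeEquivSubtypeInter _ (fun x => p ^ s • x ∈ g.range))
        (Equiv.subtypeSubtypeEquivSubtypeInter _ (fun x => p ^ s • x ∉ g.range)))))
    rw [h2, h1]
    push_cast
    ring

/-- Injective endomorphisms of a finite group are automorphisms. -/
noncomputable def addAutEquivInjective (H : Type*) [AddCommGroup H] [Finite H] :
    (H ≃+ H) ≃ {g : H →+ H // Function.Injective g} where
  toFun e := ⟨e.toAddMonoidHom, e.injective⟩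
  invFun g := AddEquiv.ofBijective g.1 (Finite.injective_iff_bijective.1 g.2)
  left_inv e := by ext; rfl
  right_inv g := by ext; rfl

theorem card_subgroup_mul_card_injective (G H : Type*) [AddCommGroup G] [AddCommGroup H]
    [Finite G] [Finite H] :
    Nat.card {K : AddSubgroup G // Nonempty (K ≃+ H)} *
      Nat.card {g : H →+ H // Function.Injective g} =
        Nat.card {g : H →+ G // Function.Injective g} := by
  have hK (K : {K : AddSubgroup G // Nonempty (K ≃+ H)}) :
      Nat.card (K.1 ≃+ H) = Nat.card {g : H →+ H // Function.Injective g} := by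
    obtain ⟨e⟩ := K.2
    refine Nat.card_congr (Equiv.trans ⟨fun e' => e.symm.trans e', fun e' => e.trans e', ?_, ?_⟩
      (addAutEquivInjective H)) <;> intro _ <;> ext <;> simp
  have : Fintype {K : AddSubgroup G // Nonempty (K ≃+ H)} := Fintype.ofFinite _
  have (K : {K : AddSubgroup G // Nonempty (K ≃+ H)}) : Finite (K.1 ≃+ H) :=
    Finite.of_injective _ DFunLike.coe_injective
  have h : Nat.card (Σ K : {K : AddSubgroup G // Nonempty (K ≃+ H)}, (K.1 ≃+ H)) =
      Nat.card {g : H →+ G // Function.Injective g} := by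
    refine Nat.card_congr (Equiv.ofBijective
      (fun q => ⟨q.1.1.subtype.comp q.2.symm.toAddMonoidHom,
        Subtype.val_injective.comp q.2.symm.injective⟩) ⟨?_, ?_⟩)
    · rintro ⟨⟨K, hK⟩, e⟩ ⟨⟨K', hK'⟩, e'⟩ heq
      have heq' : ∀ x, ((e.symm x : K) : G) = (e'.symm x : K') := fun x =>
        DFunLike.congr_fun (congrArg Subtype.val heq) x
      obtain rfl : K = K' := by
        ext x
        constructor
        · intro hx
          have hmem := (e'.symm (e ⟨x, hx⟩)).2
          rwa [← heq', e.symm_apply_apply] at hmem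
        · intro hx
          have hmem := (e.symm (e' ⟨x, hx⟩)).2
          rwa [heq', e'.symm_apply_apply] at hmem
      have : e.symm = e'.symm := AddEquiv.ext fun x => Subtype.ext (heq' x)
      obtain rfl : e = e' := by rw [← e.symm_symm, this, e'.symm_symm]
      rfl
    · rintro ⟨g, hg⟩
      exact ⟨⟨⟨g.range, ⟨(AddMonoidHom.ofInjective hg).symm⟩⟩, (AddMonoidHom.ofInjective hg).symm⟩,
        rfl⟩
  rw [← h, Nat.card_sigma, Finset.sum_congr rfl fun K _ => hK K, Finset.sum_const,
    Finset.card_univ, Nat.card_eq_fintype_card, smul_eq_mul]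

theorem lt_conj_iff {f : ℕ → ℕ} (hf : IsPartition f) {j : ℕ} (hj : 1 ≤ j) (i : ℕ) :
    i < conj f j ↔ j ≤ f i := by
  obtain ⟨hanti, N, hN⟩ := hf
  have hex : ∃ i, f i < j := ⟨N, by rw [hN N le_rfl]; omega⟩
  have key : ∀ i, j ≤ f i ↔ i < Nat.find hex := fun i => by
    constructor
    · intro h
      by_contra hlt
      exact absurd (Nat.find_spec hex) (not_lt.2 (h.trans (hanti (not_lt.1 hlt))))
    · exact fun h => not_lt.1 (Nat.find_min hex h)
  have hc : conj f j = Nat.find hex := by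
    rw [conj, Nat.card_congr ((Equiv.subtypeEquivRight key).trans Fin.equivSubtype.symm)]
    simp
  rw [hc, key]

theorem conj_mono {f g : ℕ → ℕ} (hf : IsPartition f) (hg : IsPartition g) (h : ∀ i, g i ≤ f i)
    {j : ℕ} (hj : 1 ≤ j) : conj g j ≤ conj f j := by
  by_contra! hlt
  rw [lt_conj_iff hg hj] at hlt
  exact lt_irrefl _ ((lt_conj_iff hf hj _).2 (hlt.trans (h _)))

theorem conj_succ_le {f : ℕ → ℕ} (hf : IsPartition f) {j : ℕ} (hj : 1 ≤ j) :
    conj f (j + 1) ≤ conj f j := by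
  by_contra! hlt
  rw [lt_conj_iff hf (by omega)] at hlt
  exact lt_irrefl _ ((lt_conj_iff hf hj _).2 (by omega))

theorem filter_range_eq_range_conj {f : ℕ → ℕ} (hf : IsPartition f) {a : ℕ} (ha : HasLength f a)
    {j : ℕ} (hj : 1 ≤ j) :
    (Finset.range a).filter (fun i => j ≤ f i) = Finset.range (conj f j) := by
  ext i
  rw [Finset.mem_filter, Finset.mem_range, Finset.mem_range, lt_conj_iff hf hj]
  refine ⟨And.right, fun h => ⟨?_, h⟩⟩
  by_contra hai
  have := ha.2 i (by omega)
  omega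

/-- Summation over the Young diagram of `f`, by rows and by columns. -/
theorem sum_mul_eq_sum_conj {f : ℕ → ℕ} (hf : IsPartition f) {a : ℕ} (ha : HasLength f a)
    {M : ℕ} (hM : f 0 ≤ M) (w : ℕ → ℕ) :
    ∑ i ∈ Finset.range a, w i * f i =
      ∑ j ∈ Finset.Icc 1 M, ∑ i ∈ Finset.range (conj f j), w i := by
  have h1 : ∀ i, w i * f i = ∑ j ∈ Finset.Icc 1 M, if j ≤ f i then w i else 0 := fun i => by
    rw [← Finset.sum_filter, Finset.sum_const, smul_eq_mul, mul_comm]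
    congr 1
    have : (Finset.Icc 1 M).filter (fun j => j ≤ f i) = Finset.Icc 1 (f i) := by
      ext j
      have := (hf.1 (Nat.zero_le i)).trans hM
      simp only [Finset.mem_filter, Finset.mem_Icc]
      omega
    rw [this, Nat.card_Icc, Nat.add_sub_cancel]
  rw [Finset.sum_congr rfl fun i _ => h1 i, Finset.sum_comm]
  refine Finset.sum_congr rfl fun j hj => ?_
  rw [← Finset.sum_filter, filter_range_eq_range_conj hf ha (Finset.mem_Icc.1 hj).1]

theorem nstat_eq_sum_choose {f : ℕ → ℕ} (hf : IsPartition f) {a : ℕ} (ha : HasLength f a)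
    {M : ℕ} (hM : f 0 ≤ M) : nstat f = ∑ j ∈ Finset.Icc 1 M, (conj f j).choose 2 := by
  have h : nstat f = ∑ i ∈ Finset.range a, i * f i := by
    refine finsum_eq_sum_of_support_subset _ fun i hi => ?_
    by_contra hai
    exact hi (by simp only [ha.2 i (by simpa using hai), mul_zero])
  rw [h, sum_mul_eq_sum_conj hf ha hM]
  exact Finset.sum_congr rfl fun j _ => by rw [Finset.sum_range_id, Nat.choose_two_right]

theorem sum_min_eq_sum_conj {f : ℕ → ℕ} (hf : IsPartition f) {a : ℕ} (ha : HasLength f a)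
    (k : ℕ) : ∑ i ∈ Finset.range a, min (f i) k = ∑ j ∈ Finset.Icc 1 k, conj f j := by
  have h1 : ∀ i, min (f i) k = ∑ j ∈ Finset.Icc 1 k, if j ≤ f i then 1 else 0 := fun i => by
    rw [← Finset.card_filter]
    have : (Finset.Icc 1 k).filter (fun j => j ≤ f i) = Finset.Icc 1 (min (f i) k) := by
      ext j
      simp only [Finset.mem_filter, Finset.mem_Icc]
      omega
    rw [this, Nat.card_Icc, Nat.add_sub_cancel]
  rw [Finset.sum_congr rfl fun i _ => h1 i, Finset.sum_comm]
  refine Finset.sum_congr rfl fun j hj => ?_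
  rw [← Finset.card_filter, filter_range_eq_range_conj hf ha (Finset.mem_Icc.1 hj).1,
    Finset.card_range]

theorem sum_sum_conj {f g : ℕ → ℕ} (hg : IsPartition g) {b : ℕ} (hb : HasLength g b)
    {M : ℕ} (hM : g 0 ≤ M) :
    ∑ i ∈ Finset.range b, ∑ j ∈ Finset.Icc 1 (g i), conj f j =
      ∑ j ∈ Finset.Icc 1 M, conj f j * conj g j := by
  have h1 : ∀ i, ∑ j ∈ Finset.Icc 1 (g i), conj f j =
      ∑ j ∈ Finset.Icc 1 M, if j ≤ g i then conj f j else 0 := fun i => by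
    rw [← Finset.sum_filter]
    congr 1
    ext j
    have := (hg.1 (Nat.zero_le i)).trans hM
    simp only [Finset.mem_filter, Finset.mem_Icc]
    omega
  rw [Finset.sum_congr rfl fun i _ => h1 i, Finset.sum_comm]
  refine Finset.sum_congr rfl fun j hj => ?_
  rw [← Finset.sum_filter, filter_range_eq_range_conj hg hb (Finset.mem_Icc.1 hj).1,
    Finset.sum_const, Finset.card_range, smul_eq_mul, mul_comm]

theorem prod_range_eq_prod_prod_Ico {F : Type*} [CommMonoid F] {g : ℕ → ℕ} (hg : IsPartition g)
    {b : ℕ} (hb : HasLength g b) {M : ℕ} (hM : g 0 ≤ M) (w : ℕ → ℕ → F) :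
    ∏ i ∈ Finset.range b, w (g i) i =
      ∏ j ∈ Finset.Icc 1 M, ∏ i ∈ Finset.Ico (conj g (j + 1)) (conj g j), w j i := by
  rw [← Finset.prod_fiberwise_of_maps_to (s := Finset.range b) (t := Finset.Icc 1 M) (g := g)]
  · refine Finset.prod_congr rfl fun j hj => ?_
    have hj1 := (Finset.mem_Icc.1 hj).1
    refine Finset.prod_congr ?_ fun i hi => ?_
    · ext i
      have h1 := lt_conj_iff hg hj1 i
      have h2 := lt_conj_iff hg (j := j + 1) (by omega) i
      have h3 : g i = 0 ∨ i < b := by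
        rcases lt_or_ge i b with h | h
        · exact Or.inr h
        · exact Or.inl (hb.2 i h)
      simp only [Finset.mem_filter, Finset.mem_range, Finset.mem_Ico]
      omega
    · have h1 := (lt_conj_iff hg hj1 i).1 (Finset.mem_Ico.1 hi).2
      have h2 := (lt_conj_iff hg (j := j + 1) (by omega) i).not.1
        (not_lt.2 (Finset.mem_Ico.1 hi).1)
      rw [show g i = j by omega]
  · intro i hi
    exact Finset.mem_Icc.2 ⟨hb.1 i (Finset.mem_range.1 hi), (hg.1 (Nat.zero_le i)).trans hM⟩

theorem phiPoch_mul_prod_Ico {F : Type*} [Field F] (u : F) {L a b : ℕ} (hba : b ≤ a)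
    (haL : a ≤ L) :
    phiPoch u (L - a) * ∏ i ∈ Finset.Ico b a, (1 - u ^ (L - i)) = phiPoch u (L - b) := by
  induction a, hba using Nat.le_induction with
  | base => simp
  | succ a hba ih =>
    rw [← ih (by omega), Finset.prod_Ico_succ_top hba, show L - a = L - (a + 1) + 1 by omega,
      phiPoch, phiPoch, Finset.prod_Icc_succ_top (by omega)]
    ring

theorem phiPoch_ne_zero (p : ℕ) (hp : p.Prime) (r : ℕ) : phiPoch ((p : ℚ)⁻¹) r ≠ 0 := by
  refine Finset.prod_ne_zero_iff.2 fun i hi => ?_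
  have h1 : (p : ℚ)⁻¹ < 1 := inv_lt_one_of_one_lt₀ (by exact_mod_cast hp.one_lt)
  have h2 : (p : ℚ)⁻¹ ^ i < 1 := pow_lt_one₀ (by positivity) h1
    (by have := (Finset.mem_Icc.1 hi).1; omega)
  linarith

theorem gauss_natCast_sub {F : Type*} [Field F] (u : F) {L a b : ℕ} (hba : b ≤ a) (haL : a ≤ L) :
    gauss u ((L : ℤ) - b) ((a : ℤ) - b) =
      phiPoch u (L - b) / (phiPoch u (a - b) * phiPoch u (L - a)) := by
  rw [gauss, if_pos (by omega), show ((L : ℤ) - b).toNat = L - b by omega,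
    show ((a : ℤ) - b).toNat = a - b by omega, show ((L : ℤ) - b - (a - b)).toNat = L - a by omega]

theorem card_injectiveHom_eq (p : ℕ) [Fact p.Prime] {f g : ℕ → ℕ} (hf : IsPartition f)
    (hg : IsPartition g) {a b : ℕ} (ha : HasLength f a) (hb : HasLength g b)
    (hgf : ∀ i, g i ≤ f i) {M : ℕ} (hM : g 0 ≤ M) (G : Type*) [AddCommGroup G]
    (hG : Nonempty (G ≃+ StdGroup p f a)) :
    (Nat.card {φ : StdGroup p g b →+ G // Function.Injective φ} : ℚ) =
      (p : ℚ) ^ (∑ j ∈ Finset.Icc 1 M, conj f j * conj g j) *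
        ∏ j ∈ Finset.Icc 1 M, (phiPoch ((p : ℚ)⁻¹) (conj f j - conj g (j + 1)) /
          phiPoch ((p : ℚ)⁻¹) (conj f j - conj g j)) := by
  obtain ⟨e⟩ := hG
  have hp : p.Prime := Fact.out
  have hp0 : (p : ℚ) ≠ 0 := by exact_mod_cast hp.ne_zero
  have : Finite G := Finite.of_equiv _ e.symm.toEquiv
  have htors : ∀ k, Nat.card {x : G // p ^ k • x = 0} = p ^ ∑ j ∈ Finset.Icc 1 k, conj f j := by
    intro k
    rw [← sum_min_eq_sum_conj hf ha, ← card_torsion_stdGroup]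
    refine Nat.card_congr (e.toEquiv.subtypeEquiv fun x => ?_)
    change _ ↔ p ^ k • e x = 0
    rw [← map_nsmul, map_eq_zero_iff e e.injective]
  have hfac : ∀ i ∈ Finset.range b, ((Nat.card {x : G // p ^ g i • x = 0} : ℚ) -
      p ^ i * Nat.card {x : G // p ^ (g i - 1) • x = 0}) =
      (p : ℚ) ^ (∑ j ∈ Finset.Icc 1 (g i), conj f j) *
        (1 - (p : ℚ)⁻¹ ^ (conj f (g i) - i)) := by
    intro i hi
    obtain ⟨k, hk⟩ : ∃ k, g i = k + 1 :=
      Nat.exists_eq_succ_of_ne_zero (hb.1 i (Finset.mem_range.1 hi)).ne'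
    have hlt : i < conj f (k + 1) := (lt_conj_iff hf (by omega) i).2 (hk ▸ hgf i)
    obtain ⟨c, hc⟩ := Nat.exists_eq_add_of_lt hlt
    rw [htors, htors, hk, Nat.add_sub_cancel, Finset.sum_Icc_succ_top (by omega), hc,
      show i + c + 1 - i = c + 1 by omega]
    push_cast
    rw [inv_pow]
    field_simp
    ring
  rw [card_injectiveHom_stdGroup p g hg.1 G b hb.1, Finset.prod_congr rfl hfac,
    Finset.prod_mul_distrib, Finset.prod_pow_eq_pow_sum, sum_sum_conj hg hb hM,
    prod_range_eq_prod_prod_Ico hg hb hM (fun j i => 1 - (p : ℚ)⁻¹ ^ (conj f j - i))]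
  congr 1
  refine Finset.prod_congr rfl fun j hj => ?_
  have hj1 := (Finset.mem_Icc.1 hj).1
  rw [eq_div_iff (phiPoch_ne_zero p hp _), mul_comm]
  exact phiPoch_mul_prod_Ico _ (conj_succ_le hg hj1) (conj_mono hf hg hgf hj1)

theorem choose_two_add_mul_self {F G : ℕ} (h : G ≤ F) :
    F.choose 2 + G * G = G.choose 2 + (F - G).choose 2 + F * G := by
  obtain ⟨d, rfl⟩ := Nat.exists_eq_add_of_le h
  rw [Nat.add_sub_cancel_left]
  induction d with
  | zero => simp [add_comm]
  | succ d ih =>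
    have h1 : (G + (d + 1)).choose 2 = (G + d) + (G + d).choose 2 := by
      rw [← add_assoc, Nat.choose_succ_succ' (G + d) 1, Nat.choose_one_right]
    have h2 : (d + 1).choose 2 = d + d.choose 2 := by
      rw [Nat.choose_succ_succ' d 1, Nat.choose_one_right]
    have h3 := ih (by omega)
    rw [h1, h2]
    linarith

/-- The number of subgroups of type `g` in a group of type `f`. -/
theorem card_subgroup_mul_pow_nstat (p : ℕ) [Fact p.Prime] {f g : ℕ → ℕ} (hf : IsPartition f)
    (hg : IsPartition g) {a b : ℕ} (ha : HasLength f a) (hb : HasLength g b)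
    (hgf : ∀ i, g i ≤ f i) (G : Type*) [AddCommGroup G] (hG : Nonempty (G ≃+ StdGroup p f a)) :
    (Nat.card {K : AddSubgroup G // Nonempty (K ≃+ StdGroup p g b)} : ℚ) * (p : ℚ) ^ nstat g =
      (p : ℚ) ^ nstat f * sk ((p : ℚ)⁻¹) f g := by
  have hp : p.Prime := Fact.out
  have hp0 : (p : ℚ) ≠ 0 := by exact_mod_cast hp.ne_zero
  have hφ := phiPoch_ne_zero p hp
  have : Finite G := Finite.of_equiv _ hG.some.symm.toEquiv
  have hcount := congrArg (Nat.cast (R := ℚ)) (card_subgroup_mul_card_injective G (StdGroup p g b))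
  rw [Nat.cast_mul, card_injectiveHom_eq p hf hg ha hb hgf (hgf 0) G hG,
    card_injectiveHom_eq p hg hg hb hb (fun _ => le_rfl) (hgf 0) _ ⟨AddEquiv.refl _⟩] at hcount
  have hexp : nstat f + ∑ j ∈ Finset.Icc 1 (f 0), conj g j * conj g j =
      nstat g + ∑ j ∈ Finset.Icc 1 (f 0), (conj f j - conj g j).choose 2 +
        ∑ j ∈ Finset.Icc 1 (f 0), conj f j * conj g j := by
    rw [nstat_eq_sum_choose hf ha le_rfl, nstat_eq_sum_choose hg hb (hgf 0),
      ← Finset.sum_add_distrib, ← Finset.sum_add_distrib, ← Finset.sum_add_distrib]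
    exact Finset.sum_congr rfl fun j hj =>
      choose_two_add_mul_self (conj_mono hf hg hgf (Finset.mem_Icc.1 hj).1)
  have hprod : ∏ j ∈ Finset.Icc 1 (f 0), (phiPoch ((p : ℚ)⁻¹) (conj f j - conj g (j + 1)) /
      phiPoch ((p : ℚ)⁻¹) (conj f j - conj g j)) =
      (∏ j ∈ Finset.Icc 1 (f 0), gauss ((p : ℚ)⁻¹) ((conj f j : ℤ) - (conj g (j + 1) : ℤ))
        ((conj g j : ℤ) - (conj g (j + 1) : ℤ))) *
      ∏ j ∈ Finset.Icc 1 (f 0), (phiPoch ((p : ℚ)⁻¹) (conj g j - conj g (j + 1)) /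
      phiPoch ((p : ℚ)⁻¹) (conj g j - conj g j)) := by
    rw [← Finset.prod_mul_distrib]
    refine Finset.prod_congr rfl fun j hj => ?_
    have hj1 := (Finset.mem_Icc.1 hj).1
    rw [gauss_natCast_sub _ (conj_succ_le hg hj1) (conj_mono hf hg hgf hj1), Nat.sub_self,
      show phiPoch ((p : ℚ)⁻¹) 0 = 1 by simp [phiPoch]]
    have h1 := hφ (conj g j - conj g (j + 1))
    rw [div_one, div_mul_eq_mul_div, mul_comm (phiPoch _ (conj g j - _)),
      mul_div_mul_right _ _ h1]
  rw [hprod] at hcount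
  have hne : ∏ j ∈ Finset.Icc 1 (f 0), (phiPoch ((p : ℚ)⁻¹) (conj g j - conj g (j + 1)) /
      phiPoch ((p : ℚ)⁻¹) (conj g j - conj g j)) ≠ 0 :=
    Finset.prod_ne_zero_iff.2 fun j _ => div_ne_zero (hφ _) (hφ _)
  rw [← mul_assoc, ← mul_assoc] at hcount
  have hcount' := mul_right_cancel₀ hne hcount
  have hpow := congrArg (fun n => (p : ℚ) ^ n) hexp
  simp only [pow_add] at hpow
  rw [sk]
  refine mul_right_cancel₀ (pow_ne_zero (∑ j ∈ Finset.Icc 1 (f 0), conj g j * conj g j) hp0) ?_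
  rw [mul_right_comm, hcount', mul_right_comm _ (_ * _), hpow, inv_pow]
  field_simp

theorem nstat_mono {f g : ℕ → ℕ} (hf : IsPartition f) (hg : IsPartition g) {a b : ℕ}
    (ha : HasLength f a) (hb : HasLength g b) (hgf : ∀ i, g i ≤ f i) : nstat g ≤ nstat f := by
  rw [nstat_eq_sum_choose hf ha le_rfl, nstat_eq_sum_choose hg hb (hgf 0)]
  exact Finset.sum_le_sum fun j hj =>
    Nat.choose_le_choose 2 (conj_mono hf hg hgf (Finset.mem_Icc.1 hj).1)

/-- Chains of subgroups `G = C 0 ⊇ ⋯ ⊇ C m` with `C i` of prescribed type. -/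
abbrev SubgroupChain (G : Type) [AddCommGroup G] (H : ℕ → Type) [∀ i, AddCommGroup (H i)]
    (m : ℕ) : Type :=
  {C : Fin (m + 1) → AddSubgroup G // C 0 = ⊤ ∧ (∀ i j : Fin (m + 1), i ≤ j → C j ≤ C i) ∧
    ∀ i : Fin (m + 1), Nonempty (C i ≃+ H (i : ℕ))}

/-- A chain of length `m + 1` is a chain of length `m` with a further subgroup of its last term. -/
def subgroupChainSucc (G : Type) [AddCommGroup G] (H : ℕ → Type) [∀ i, AddCommGroup (H i)]
    (m : ℕ) :
    SubgroupChain G H (m + 1) ≃ Σ C : SubgroupChain G H m,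
      {K : AddSubgroup G // K ≤ C.1 (Fin.last m) ∧ Nonempty (K ≃+ H (m + 1))} where
  toFun C := ⟨⟨fun i => C.1 i.castSucc, C.2.1,
      fun i j hij => C.2.2.1 _ _ (Fin.castSucc_le_castSucc_iff.2 hij),
      fun i => C.2.2.2 i.castSucc⟩,
    ⟨C.1 (Fin.last (m + 1)), C.2.2.1 _ _ (Fin.le_last _), C.2.2.2 (Fin.last (m + 1))⟩⟩
  invFun q := ⟨Fin.snoc (α := fun _ => AddSubgroup G) q.1.1 q.2.1, by
    obtain ⟨⟨C, h0, hanti, hC⟩, ⟨K, hK, hKH⟩⟩ := q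
    refine ⟨?_, fun i j hij => ?_, fun i => ?_⟩
    · exact (Fin.snoc_castSucc (α := fun _ => AddSubgroup G) K C 0).trans h0
    · induction j using Fin.lastCases with
      | last =>
        induction i using Fin.lastCases with
        | last => exact le_rfl
        | cast i =>
          rw [Fin.snoc_castSucc, Fin.snoc_last]
          exact hK.trans (hanti _ _ (Fin.le_last i))
      | cast j =>
        induction i using Fin.lastCases with
        | last => exact absurd hij (not_le.2 (Fin.castSucc_lt_last j))
        | cast i =>
          rw [Fin.snoc_castSucc, Fin.snoc_castSucc]
          exact hanti _ _ (Fin.castSucc_le_castSucc_iff.1 hij)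
    · induction i using Fin.lastCases with
      | last => rw [Fin.snoc_last]; exact hKH
      | cast i => rw [Fin.snoc_castSucc]; exact hC i⟩
  left_inv C := by
    apply Subtype.ext
    funext i
    refine Fin.lastCases ?_ (fun j => ?_) i
    · simp
    · simp
  right_inv q := by
    obtain ⟨⟨C, h0, hanti, hC⟩, ⟨K, hK, hKH⟩⟩ := q
    apply Sigma.ext
    · apply Subtype.ext
      funext i
      simp
    · rw [Subtype.heq_iff_coe_eq]
      · simp
      · intro y
        simp

/-- Subgroups of `G` below `L` of a given type are subgroups of `L` of that type. -/
def subgroupLeEquiv {G : Type*} [AddCommGroup G] (L : AddSubgroup G) (H : Type*)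
    [AddCommGroup H] :
    {K : AddSubgroup L // Nonempty (K ≃+ H)} ≃
      {K : AddSubgroup G // K ≤ L ∧ Nonempty (K ≃+ H)} :=
  ((AddSubgroup.MapSubtype.orderIso L).toEquiv.subtypeEquiv
    (q := fun K => Nonempty (K.1 ≃+ H)) fun K =>
      ⟨fun ⟨e⟩ => ⟨((K.equivMapOfInjective L.subtype L.subtype_injective).symm.trans e)⟩,
        fun ⟨e⟩ => ⟨((K.equivMapOfInjective L.subtype L.subtype_injective).trans e)⟩⟩).trans
    (Equiv.subtypeSubtypeEquivSubtypeInter _ (fun K : AddSubgroup G => Nonempty (K ≃+ H)))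

theorem card_subgroupChain_mul_pow_nstat (p : ℕ) [Fact p.Prime] (μ : ℕ → ℕ → ℕ) (len : ℕ → ℕ)
    (G : Type) [AddCommGroup G] (hG : Nonempty (G ≃+ StdGroup p (μ 0) (len 0))) (m : ℕ)
    (hpart : ∀ i ≤ m, IsPartition (μ i)) (hlen : ∀ i ≤ m, HasLength (μ i) (len i))
    (hnested : ∀ i < m, ∀ j, μ (i + 1) j ≤ μ i j) :
    (Nat.card (SubgroupChain G (fun i => StdGroup p (μ i) (len i)) m) : ℚ) * p ^ nstat (μ m) =
      (p : ℚ) ^ nstat (μ 0) * ∏ i ∈ Finset.Icc 1 m, sk ((p : ℚ)⁻¹) (μ (i - 1)) (μ i) := by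
  have : Finite G := Finite.of_equiv _ hG.some.symm.toEquiv
  induction m with
  | zero =>
    have : Unique (SubgroupChain G (fun i => StdGroup p (μ i) (len i)) 0) :=
      { default := ⟨fun _ => ⊤, rfl, fun _ _ _ => le_rfl, fun i => by
          obtain rfl : i = 0 := Fin.fin_one_eq_zero i
          exact ⟨AddSubgroup.topEquiv.trans hG.some⟩⟩
        uniq := fun C => Subtype.ext (funext fun i => by
          obtain rfl : i = 0 := Fin.fin_one_eq_zero i
          exact C.2.1) }
    simp
  | succ m ih =>
    have ih' := ih (fun i hi => hpart i (by omega)) (fun i hi => hlen i (by omega))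
      fun i hi => hnested i (by omega)
    have hfib (C : SubgroupChain G (fun i => StdGroup p (μ i) (len i)) m) :
        (Nat.card {K : AddSubgroup G // K ≤ C.1 (Fin.last m) ∧
          Nonempty (K ≃+ StdGroup p (μ (m + 1)) (len (m + 1)))} : ℚ) * p ^ nstat (μ (m + 1)) =
          p ^ nstat (μ m) * sk ((p : ℚ)⁻¹) (μ m) (μ (m + 1)) := by
      rw [← Nat.card_congr (subgroupLeEquiv _ _)]
      exact card_subgroup_mul_pow_nstat p (hpart m (by omega)) (hpart (m + 1) le_rfl)
        (hlen m (by omega)) (hlen (m + 1) le_rfl) (hnested m (by omega)) _ (C.2.2.2 (Fin.last m))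
    have : Fintype (SubgroupChain G (fun i => StdGroup p (μ i) (len i)) m) := Fintype.ofFinite _
    rw [Nat.card_congr (subgroupChainSucc G _ m), Nat.card_sigma, Nat.cast_sum, Finset.sum_mul,
      Finset.sum_congr rfl fun C _ => hfib C, Finset.sum_const, Finset.card_univ,
      ← Nat.card_eq_fintype_card, nsmul_eq_mul, ← mul_assoc, ih',
      Finset.prod_Icc_succ_top (by omega), Nat.add_sub_cancel, mul_assoc]

/-- Let `p` be an odd prime, `m ≥ 1`, and `μ⁽⁰⁾ ⊇ μ⁽¹⁾ ⊇ ⋯ ⊇ μ⁽ᵐ⁾`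
partitions (with `l(μ⁽ⁱ⁾) = len i`).  If `G` is a finite abelian `p`-group of type `μ⁽⁰⁾`,
then the number of chains of subgroups `G = G₀ ⊇ G₁ ⊇ ⋯ ⊇ G_m` with `G_i` of type `μ⁽ⁱ⁾`
equals `p^{n(μ⁽⁰⁾) - n(μ⁽ᵐ⁾)} ∏_{i=1}^{m} sk_{μ⁽ⁱ⁻¹⁾/μ⁽ⁱ⁾}(p⁻¹)` in `ℚ`. -/
theorem stmt9 (p : ℕ) (hp : p.Prime) (hodd : p ≠ 2) (m : ℕ) (hm : 1 ≤ m)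
    (μ : ℕ → ℕ → ℕ) (len : ℕ → ℕ)
    (hpart : ∀ i ≤ m, IsPartition (μ i))
    (hlen : ∀ i ≤ m, HasLength (μ i) (len i))
    (hnested : ∀ i < m, ∀ j, μ (i + 1) j ≤ μ i j)
    (G : Type) [AddCommGroup G]
    (hG : Nonempty (G ≃+ (∀ j : Fin (len 0), ZMod (p ^ μ 0 (j : ℕ))))) :
    (Nat.card {C : Fin (m + 1) → AddSubgroup G //
        C 0 = ⊤ ∧ (∀ i j : Fin (m + 1), i ≤ j → C j ≤ C i) ∧
          ∀ i : Fin (m + 1),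
            Nonempty (C i ≃+ (∀ j : Fin (len (i : ℕ)), ZMod (p ^ μ (i : ℕ) (j : ℕ))))} : ℚ)
      = (p : ℚ) ^ (nstat (μ 0) - nstat (μ m)) *
          ∏ i ∈ Finset.Icc 1 m, sk ((p : ℚ)⁻¹) (μ (i - 1)) (μ i) := by
  have : Fact p.Prime := ⟨hp⟩
  have hp0 : (p : ℚ) ≠ 0 := by exact_mod_cast hp.ne_zero
  have hle : ∀ i ≤ m, ∀ j, μ i j ≤ μ 0 j := by
    intro i
    induction i with
    | zero => exact fun _ _ => le_rfl
    | succ i ih => exact fun hi j => (hnested i (by omega) j).trans (ih (by omega) j)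
  have hn : nstat (μ m) ≤ nstat (μ 0) := nstat_mono (hpart 0 (by omega)) (hpart m le_rfl)
    (hlen 0 (by omega)) (hlen m le_rfl) (hle m le_rfl)
  have h := card_subgroupChain_mul_pow_nstat p μ len G hG m hpart hlen hnested
  refine mul_right_cancel₀ (pow_ne_zero (nstat (μ m)) hp0) (h.trans ?_)
  rw [mul_right_comm, ← pow_add, Nat.sub_add_cancel hn]

end EK
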